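/- arXiv:1009.2029 — 2 statements merged into one kernel-verified Lean document; each statement's English description precedes it below -/
import Mathlib

section
/- Let E_∞ and E_N (N ≥ 1) be locally compact Hausdorff topological spaces with countable bases, Λ^{N+1}_N Feller Markov kernels from E_{N+1} to E_N and Λ^∞_N Feller Markov kernels from E_∞ to E_N with Λ^∞_{N+1} ∘ Λ^{N+1}_N = Λ^∞_N, and assume μ ↦ (μΛ^∞_N)_{N≥1} is injective on Borel probability measures on E_∞. For each N let (P_N(t))_{t≥0} be a Feller Markov semigroup on E_N, that is: P_N(s) ∘ P_N(t) = P_N(s+t), each P_N(t) maps C₀(E_N) into C₀(E_N), and t ↦ P_N(t)f_N is continuous from [0,∞) to C₀(E_N) for every f_N ∈ C₀(E_N). Suppose (P(t))_{t≥0} is a family of Markov kernels from E_∞ to E_∞ satisfying P(t) ∘ Λ^∞_N = Λ^∞_N ∘ P_N(t) for all t and N. Then (P(t))_{t≥0} is a Feller semigroup on E_∞: for every f ∈ C₀(E_∞) one has P(t)f ∈ C₀(E_∞) for all t ≥ 0, and t ↦ P(t)f is continuous from [0,∞) to C₀(E_∞) in the supremum norm. -/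
open MeasureTheory ProbabilityTheory
open scoped ZeroAtInfty NNReal

/-- A Markov kernel between topological measurable spaces is *Feller* if for every
`f ∈ C₀` of the target, the induced function `x ↦ ∫ f d(K x)` is continuous and
vanishes at infinity. -/
def IsFellerKernel {α β : Type} [TopologicalSpace α] [TopologicalSpace β]
    [MeasurableSpace α] [MeasurableSpace β] (K : Kernel α β) : Prop :=
  ∀ f : C₀(β, ℝ),
    Continuous (fun x => ∫ y, f y ∂(K x)) ∧
      Filter.Tendsto (fun x => ∫ y, f y ∂(K x)) (Filter.cocompact α) (nhds 0)

/-- Compactly supported continuous functions are uniformly dense in `C₀`. -/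
theorem ZeroAtInftyContinuousMap.exists_compactlySupported_abs_sub_le {X : Type*}
    [TopologicalSpace X] [T2Space X] (f : C₀(X, ℝ)) {ε : ℝ} (hε : 0 < ε) :
    ∃ g : CompactlySupportedContinuousMap X ℝ, ∀ x, |f x - g x| ≤ ε := by
  have hsmall : {x | |f x| < ε} ∈ Filter.cocompact X := by
    have h := (zero_at_infty f).eventually (Metric.ball_mem_nhds 0 hε)
    filter_upwards [h] with x hx
    simpa using hx
  obtain ⟨K, hK, hKsub⟩ := Filter.mem_cocompact.mp hsmall
  refine ⟨⟨⟨fun x => f x - max (-ε) (min (f x) ε), by fun_prop⟩, ?_⟩, fun x => ?_⟩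
  · refine HasCompactSupport.intro hK fun x hx => ?_
    have hx' : |f x| < ε := hKsub hx
    rw [abs_lt] at hx'
    show f x - max (-ε) (min (f x) ε) = 0
    rw [min_eq_left hx'.2.le, max_eq_right hx'.1.le, sub_self]
  · show |f x - (f x - max (-ε) (min (f x) ε))| ≤ ε
    rw [sub_sub_cancel, abs_le]
    exact ⟨le_max_left _ _, max_le (by linarith) (min_le_right _ _)⟩

theorem ZeroAtInftyContinuousMap.integrable {X : Type*} [TopologicalSpace X] [MeasurableSpace X]
    [BorelSpace X] (f : C₀(X, ℝ)) (μ : Measure X) [IsFiniteMeasure μ] :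
    Integrable f μ := by
  refine Integrable.of_bound (map_continuous f).measurable.aestronglyMeasurable ‖f‖ ?_
  exact Filter.Eventually.of_forall fun x => f.toBCF.norm_coe_le_norm x

theorem ZeroAtInftyContinuousMap.abs_apply_le_norm {X : Type*} [TopologicalSpace X]
    (f : C₀(X, ℝ)) (x : X) : |f x| ≤ ‖f‖ :=
  f.toBCF.norm_coe_le_norm x

theorem ZeroAtInftyContinuousMap.norm_le_of_forall_abs_le {X : Type*} [TopologicalSpace X]
    {f : C₀(X, ℝ)} {c : ℝ} (hc : 0 ≤ c) (h : ∀ x, |f x| ≤ c) : ‖f‖ ≤ c :=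
  (BoundedContinuousFunction.norm_le (f := f.toBCF) hc).mpr h

/-- A finite measure on a locally compact second countable Hausdorff space is determined by the
integrals of `C₀` functions. -/
theorem MeasureTheory.Measure.ext_of_integral_eq_on_zeroAtInfty {X : Type*} [TopologicalSpace X]
    [T2Space X] [LocallyCompactSpace X] [SecondCountableTopology X] [MeasurableSpace X]
    [BorelSpace X] {μ ν : Measure X} [IsFiniteMeasure μ] [IsFiniteMeasure ν]
    (h : ∀ f : C₀(X, ℝ), ∫ x, f x ∂μ = ∫ x, f x ∂ν) : μ = ν :=
  Measure.ext_of_integral_eq_on_compactlySupported fun f => h (f : C₀(X, ℝ))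

/-- Averages against a measure move by at most `c` if the integrand moves by at most `c`. -/
theorem abs_integral_sub_integral_le {X : Type*} [MeasurableSpace X] {μ : Measure X}
    [IsFiniteMeasure μ] {f g : X → ℝ} (hf : Integrable f μ) (hg : Integrable g μ) {c : ℝ}
    (h : ∀ x, |f x - g x| ≤ c) : |∫ x, f x ∂μ - ∫ x, g x ∂μ| ≤ c * μ.real Set.univ := by
  rw [← integral_sub hf hg]
  exact norm_integral_le_of_norm_le_const (f := fun x => f x - g x) (Filter.Eventually.of_forall h)

/-- **Riesz representation on `C₀`**, for a linear functional dominated by `C * sup f⁺`. -/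
theorem exists_isFiniteMeasure_integral_eq {X : Type*} [TopologicalSpace X] [T2Space X]
    [LocallyCompactSpace X] [MeasurableSpace X] [BorelSpace X] (ψ : C₀(X, ℝ) →ₗ[ℝ] ℝ) (C : ℝ)
    (hψ : ∀ (f : C₀(X, ℝ)) (a : ℝ), 0 ≤ a → (∀ x, f x ≤ a) → ψ f ≤ C * a) :
    ∃ μ : Measure X, IsFiniteMeasure μ ∧ ∀ f : C₀(X, ℝ), ψ f = ∫ x, f x ∂μ := by
  let Λ : CompactlySupportedContinuousMap X ℝ →ₚ[ℝ] ℝ := PositiveLinearMap.mk₀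
    { toFun := fun f => ψ (f : C₀(X, ℝ))
      map_add' := fun f g => ψ.map_add (f : C₀(X, ℝ)) (g : C₀(X, ℝ))
      map_smul' := fun c f => ψ.map_smul c (f : C₀(X, ℝ)) }
    (by
      intro f hf
      have h := hψ (-(f : C₀(X, ℝ))) 0 le_rfl fun x => neg_nonpos.mpr (hf x)
      rw [map_neg, mul_zero] at h
      exact neg_nonpos.mp h)
  have hΛ (f : CompactlySupportedContinuousMap X ℝ) : Λ f = ψ (f : C₀(X, ℝ)) := rfl
  have hfin : IsFiniteMeasure (RealRMK.rieszMeasure Λ) := by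
    refine ⟨lt_of_le_of_lt ?_ (ENNReal.ofReal_lt_top (r := C * 1))⟩
    rw [isOpen_univ.measure_eq_iSup_isCompact]
    refine iSup₂_le fun K _ => iSup_le fun hK => ?_
    obtain ⟨g, hgK, -, hgc, hg⟩ :=
      exists_continuous_one_zero_of_isCompact hK isClosed_empty (Set.disjoint_empty K)
    refine (RealRMK.rieszMeasure_le_of_eq_one Λ (f := ⟨g, hgc⟩) (fun x => (hg x).1) hK
      fun x hx => hgK hx).trans ?_
    exact ENNReal.ofReal_le_ofReal (hψ _ 1 zero_le_one fun x => (hg x).2)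
  refine ⟨RealRMK.rieszMeasure Λ, hfin, fun f => ?_⟩
  set μ := RealRMK.rieszMeasure Λ
  refine eq_of_abs_sub_le_all fun ε hε => ?_
  set M := |C| + μ.real Set.univ + 1 with hM
  have hM0 : 0 < M := by positivity
  obtain ⟨g, hg⟩ := f.exists_compactlySupported_abs_sub_le (div_pos hε hM0)
  have h1 : |ψ f - ψ (g : C₀(X, ℝ))| ≤ |C| * (ε / M) := by
    have hCa : C * (ε / M) ≤ |C| * (ε / M) := by gcongr; exact le_abs_self C
    rw [← map_sub, abs_le]
    constructor
    · have h := hψ (-(f - (g : C₀(X, ℝ)))) (ε / M) (by positivity) fun x => by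
        show -(f x - g x) ≤ _
        linarith [(abs_le.mp (hg x)).1]
      rw [map_neg] at h
      linarith
    · exact (hψ _ (ε / M) (by positivity) fun x => (abs_le.mp (hg x)).2).trans hCa
  have h2 : |∫ x, f x ∂μ - ∫ x, g x ∂μ| ≤ ε / M * μ.real Set.univ :=
    abs_integral_sub_integral_le (f.integrable μ) ((g : C₀(X, ℝ)).integrable μ) hg
  rw [RealRMK.integral_rieszMeasure, hΛ] at h2
  have h3 : ε = (|C| + μ.real Set.univ + 1) * (ε / M) := by rw [← hM]; field_simp
  have h4 : 0 ≤ ε / M := by positivity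
  calc |ψ f - ∫ x, f x ∂μ|
      ≤ |ψ f - ψ (g : C₀(X, ℝ))| + |∫ x, f x ∂μ - ψ (g : C₀(X, ℝ))| := by
        rw [abs_sub_comm (∫ x, f x ∂μ)]; exact abs_sub_le _ _ _
    _ ≤ ε := by linarith

/-- Every continuous linear functional on `C₀` is a difference of integrals against two finite
measures. The decomposition is obtained by extending the functional, along `f ↦ (f, -f)`, to
`C₀ × C₀` dominated by a multiple of the supremum of the positive parts. -/
theorem exists_isFiniteMeasure_integral_sub_integral_eq {X : Type*} [TopologicalSpace X]
    [T2Space X] [LocallyCompactSpace X] [MeasurableSpace X] [BorelSpace X]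
    (φ : StrongDual ℝ C₀(X, ℝ)) :
    ∃ μ ν : Measure X, IsFiniteMeasure μ ∧ IsFiniteMeasure ν ∧
      ∀ f : C₀(X, ℝ), φ f = ∫ x, f x ∂μ - ∫ x, f x ∂ν := by
  let m : C₀(X, ℝ) × C₀(X, ℝ) → X → ℝ := fun p x => max (max (p.1 x) (p.2 x)) 0
  have hm0 (p x) : 0 ≤ m p x := le_max_right _ _
  have hbdd (p) : BddAbove (Set.range (m p)) := by
    refine ⟨max ‖p.1‖ ‖p.2‖, ?_⟩
    rintro _ ⟨x, rfl⟩
    refine max_le (max_le_max ?_ ?_) ((norm_nonneg _).trans (le_max_left _ _))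
    · exact (le_abs_self _).trans (p.1.abs_apply_le_norm x)
    · exact (le_abs_self _).trans (p.2.abs_apply_le_norm x)
  let S : C₀(X, ℝ) × C₀(X, ℝ) → ℝ := fun p => ⨆ x, m p x
  have hS0 (p) : 0 ≤ S p := Real.iSup_nonneg (hm0 p)
  have hle (p x) : m p x ≤ S p := le_ciSup (hbdd p) x
  have hφ0 := norm_nonneg φ
  let d : C₀(X, ℝ) →ₗ[ℝ] C₀(X, ℝ) × C₀(X, ℝ) := LinearMap.prod LinearMap.id (-LinearMap.id)
  have hd : Function.Injective d := fun f g h => congrArg Prod.fst h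
  let e := LinearEquiv.ofInjective d hd
  obtain ⟨Φ, hΦ, hΦle⟩ := exists_extension_of_le_sublinear
    (⟨LinearMap.range d, φ.toLinearMap ∘ₗ e.symm.toLinearMap⟩ :
      C₀(X, ℝ) × C₀(X, ℝ) →ₗ.[ℝ] ℝ) (fun p => ‖φ‖ * S p)
    (by
      intro c hc p
      have : S (c • p) = c * S p := by
        show ⨆ x, m (c • p) x = c * ⨆ x, m p x
        rw [Real.mul_iSup_of_nonneg hc.le]
        refine iSup_congr fun x => ?_
        show max (max (c * p.1 x) (c * p.2 x)) 0 = c * max (max (p.1 x) (p.2 x)) 0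
        rw [mul_max_of_nonneg _ _ hc.le, mul_max_of_nonneg _ _ hc.le, mul_zero]
      rw [this]; ring)
    (by
      intro p q
      rw [← mul_add]
      refine mul_le_mul_of_nonneg_left ?_ hφ0
      refine Real.iSup_le (fun x => ?_) (add_nonneg (hS0 p) (hS0 q))
      refine le_trans ?_ (add_le_add (hle p x) (hle q x))
      refine max_le (max_le ?_ ?_) (add_nonneg (hm0 p x) (hm0 q x))
      · exact add_le_add ((le_max_left _ _).trans (le_max_left _ _))
          ((le_max_left _ _).trans (le_max_left _ _))
      · exact add_le_add ((le_max_right _ _).trans (le_max_left _ _))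
          ((le_max_right _ _).trans (le_max_left _ _)))
    (by
      rintro ⟨_, f, rfl⟩
      show φ (e.symm (e f)) ≤ ‖φ‖ * S (f, -f)
      rw [e.symm_apply_apply]
      refine (le_abs_self _).trans ((φ.le_opNorm f).trans (mul_le_mul_of_nonneg_left ?_ hφ0))
      refine ZeroAtInftyContinuousMap.norm_le_of_forall_abs_le (hS0 _) fun x => ?_
      exact (le_max_left _ _).trans (hle (f, -f) x))
  have hΦd (f) : Φ (f, -f) = φ f := by
    have h := hΦ ⟨d f, f, rfl⟩
    have h' : e.symm (e f) = f := e.symm_apply_apply f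
    exact h.trans (congrArg φ h')
  obtain ⟨μ, hμ, hμf⟩ := exists_isFiniteMeasure_integral_eq
    (Φ ∘ₗ LinearMap.inl ℝ C₀(X, ℝ) C₀(X, ℝ)) ‖φ‖ fun f a ha hf =>
      (hΦle (f, 0)).trans <| mul_le_mul_of_nonneg_left
        (Real.iSup_le (fun x => max_le (max_le (hf x) ha) ha) ha) hφ0
  obtain ⟨ν, hν, hνf⟩ := exists_isFiniteMeasure_integral_eq
    (Φ ∘ₗ LinearMap.inr ℝ C₀(X, ℝ) C₀(X, ℝ)) ‖φ‖ fun f a ha hf =>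
      (hΦle (0, f)).trans <| mul_le_mul_of_nonneg_left
        (Real.iSup_le (fun x => max_le (max_le ha (hf x)) ha) ha) hφ0
  refine ⟨μ, ν, hμ, hν, fun f => ?_⟩
  rw [← hμf, ← hνf, ← hΦd, LinearMap.comp_apply, LinearMap.comp_apply, LinearMap.inl_apply,
    LinearMap.inr_apply, ← map_sub]
  simp

/-- The operator on `C₀` induced by a Feller Markov kernel. -/
noncomputable def IsFellerKernel.toLinearMap {α β : Type} [TopologicalSpace α]
    [TopologicalSpace β] [MeasurableSpace α] [MeasurableSpace β] [BorelSpace β]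
    {K : Kernel α β} [IsMarkovKernel K] (hK : IsFellerKernel K) :
    C₀(β, ℝ) →ₗ[ℝ] C₀(α, ℝ) where
  toFun f := ⟨⟨fun x => ∫ y, f y ∂(K x), (hK f).1⟩, (hK f).2⟩
  map_add' f g := by
    ext x
    exact integral_add (f.integrable (K x)) (g.integrable (K x))
  map_smul' c f := by
    ext x
    exact integral_const_mul c f

theorem IsFellerKernel.toLinearMap_apply {α β : Type} [TopologicalSpace α]
    [TopologicalSpace β] [MeasurableSpace α] [MeasurableSpace β] [BorelSpace β]
    {K : Kernel α β} [IsMarkovKernel K] (hK : IsFellerKernel K) (f : C₀(β, ℝ)) (x : α) :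
    hK.toLinearMap f x = ∫ y, f y ∂(K x) := rfl

/-- If finite measures have the same image under every kernel of a family that separates
probability measures, then they are equal. -/
theorem eq_of_forall_bind_eq {X : Type*} {ι : Type*} [Nonempty ι] {E : ι → Type*}
    [MeasurableSpace X] [∀ i, MeasurableSpace (E i)] (L : ∀ i, Kernel X (E i))
    [∀ i, IsMarkovKernel (L i)]
    (hinj : ∀ μ μ' : Measure X, IsProbabilityMeasure μ → IsProbabilityMeasure μ' →
      (∀ i, μ.bind (L i) = μ'.bind (L i)) → μ = μ')
    (μ ν : Measure X) [IsFiniteMeasure μ] [IsFiniteMeasure ν]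
    (h : ∀ i, μ.bind (L i) = ν.bind (L i)) : μ = ν := by
  have hmass : μ Set.univ = ν Set.univ := by
    obtain ⟨i⟩ := ‹Nonempty ι›
    have := congrArg (fun ρ => ρ Set.univ) (h i)
    simpa [Measure.bind_apply MeasurableSet.univ (L i).aemeasurable] using this
  by_cases hμ : μ = 0
  · have hν : ν = 0 := by rw [← Measure.measure_univ_eq_zero, ← hmass, hμ]; simp
    rw [hμ, hν]
  have hμ0 : μ Set.univ ≠ 0 := by rwa [Ne, Measure.measure_univ_eq_zero]
  have key : (μ Set.univ)⁻¹ • μ = (μ Set.univ)⁻¹ • ν := by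
    refine hinj _ _ ⟨?_⟩ ⟨?_⟩ fun i => ?_
    · simp [ENNReal.inv_mul_cancel hμ0 (measure_ne_top μ _)]
    · simp [← hmass, ENNReal.inv_mul_cancel hμ0 (measure_ne_top μ _)]
    · rw [Measure.comp_smul, Measure.comp_smul, h i]
  have := congrArg (fun ρ => μ Set.univ • ρ) key
  simpa [smul_smul, ENNReal.mul_inv_cancel hμ0 (measure_ne_top μ _)] using this

/-- If the Feller kernels `L N` form a coherent family that separates probability measures, then
functions of the form `L N g` are uniformly dense in `C₀`. -/
theorem exists_abs_sub_integral_le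
    (E : ℕ → Type) (X : Type)
    [∀ N, TopologicalSpace (E N)] [∀ N, T2Space (E N)] [∀ N, LocallyCompactSpace (E N)]
    [∀ N, SecondCountableTopology (E N)] [∀ N, MeasurableSpace (E N)] [∀ N, BorelSpace (E N)]
    [TopologicalSpace X] [T2Space X] [LocallyCompactSpace X] [MeasurableSpace X] [BorelSpace X]
    (K : ∀ N : ℕ, Kernel (E (N + 1)) (E N)) (L : ∀ N : ℕ, Kernel X (E N))
    [∀ N, IsMarkovKernel (K N)] [∀ N, IsMarkovKernel (L N)]
    (hK : ∀ N, IsFellerKernel (K N)) (hL : ∀ N, IsFellerKernel (L N))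
    (hcomm : ∀ N, (K N) ∘ₖ (L (N + 1)) = L N)
    (hinj : ∀ μ μ' : Measure X, IsProbabilityMeasure μ → IsProbabilityMeasure μ' →
      (∀ N, μ.bind (L N) = μ'.bind (L N)) → μ = μ')
    (f : C₀(X, ℝ)) {ε : ℝ} (hε : 0 < ε) :
    ∃ (N : ℕ) (g : C₀(E N, ℝ)), ∀ x, |f x - ∫ y, g y ∂(L N x)| ≤ ε := by
  let V : ℕ → Submodule ℝ C₀(X, ℝ) := fun N => LinearMap.range (hL N).toLinearMap
  have hmono : Monotone V := by
    refine monotone_nat_of_le_succ fun N => ?_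
    rintro _ ⟨g, rfl⟩
    refine ⟨(hK N).toLinearMap g, ?_⟩
    ext x
    simp only [IsFellerKernel.toLinearMap_apply]
    rw [← Kernel.integral_comp (g.integrable _), hcomm]
  let W : Submodule ℝ C₀(X, ℝ) := ⨆ N, V N
  have hdense : f ∈ W.topologicalClosure := by
    by_contra hf
    obtain ⟨φ, u, hlt, hu⟩ := geometric_hahn_banach_closed_point
      W.topologicalClosure.convex W.isClosed_topologicalClosure hf
    have hφW (w) (hw : w ∈ W) : φ w = 0 := by
      by_contra hne
      have := hlt _ (W.le_topologicalClosure (W.smul_mem (u / φ w) hw))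
      rw [map_smul, smul_eq_mul, div_mul_cancel₀ _ hne] at this
      exact lt_irrefl _ this
    have hu0 : 0 < u := by simpa using hlt 0 (Submodule.zero_mem _)
    obtain ⟨μ, ν, hμ, hν, hφ⟩ := exists_isFiniteMeasure_integral_sub_integral_eq φ
    have hμν : μ = ν := by
      refine eq_of_forall_bind_eq L hinj μ ν fun N => ?_
      refine Measure.ext_of_integral_eq_on_zeroAtInfty fun g => ?_
      rw [Measure.comp_eq_comp_const_apply, Measure.comp_eq_comp_const_apply,
        Kernel.integral_comp (g.integrable _), Kernel.integral_comp (g.integrable _),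
        Kernel.const_apply, Kernel.const_apply]
      have h := hφW _ (Submodule.mem_iSup_of_mem (p := V) N ⟨g, rfl⟩)
      rw [hφ] at h
      exact sub_eq_zero.mp h
    have : φ f = 0 := by rw [hφ, hμν, sub_self]
    linarith
  obtain ⟨w, hw, hdist⟩ := Metric.mem_closure_iff.mp hdense ε hε
  obtain ⟨N, g, rfl⟩ := (Submodule.mem_iSup_of_directed V hmono.directed_le).mp hw
  refine ⟨N, g, fun x => ?_⟩
  rw [dist_eq_norm] at hdist
  exact ((f - (hL N).toLinearMap g).abs_apply_le_norm x).trans hdist.le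

/-- Proposition 1.4 of Borodin–Olshanski, Feller part: in the Feller boundary setting,
if the semigroups `(P_N(t))` on the levels are Feller (each `P_N(t)` preserves `C₀` and
`t ↦ P_N(t)f` is sup-norm continuous) and `(P(t))` is a family of Markov kernels on `E_∞`
with `P(t) ∘ Λ^∞_N = Λ^∞_N ∘ P_N(t)`, then `(P(t))` is a Feller semigroup on `E_∞`:
each `P(t)` maps `C₀(E_∞)` to `C₀(E_∞)` and `t ↦ P(t)f` is continuous in the sup norm. -/
theorem stmt5
    (E : ℕ → Type) (Einf : Type)
    [∀ N, TopologicalSpace (E N)] [∀ N, T2Space (E N)] [∀ N, LocallyCompactSpace (E N)]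
    [∀ N, SecondCountableTopology (E N)] [∀ N, MeasurableSpace (E N)] [∀ N, BorelSpace (E N)]
    [TopologicalSpace Einf] [T2Space Einf] [LocallyCompactSpace Einf]
    [SecondCountableTopology Einf] [MeasurableSpace Einf] [BorelSpace Einf]
    (Lk : ∀ N : ℕ, Kernel (E (N + 1)) (E N)) (Linf : ∀ N : ℕ, Kernel Einf (E N))
    [∀ N, IsMarkovKernel (Lk N)] [∀ N, IsMarkovKernel (Linf N)]
    (hLkFeller : ∀ N, IsFellerKernel (Lk N)) (hLinfFeller : ∀ N, IsFellerKernel (Linf N))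
    (hcomm : ∀ N, (Lk N) ∘ₖ (Linf (N + 1)) = Linf N)
    (hinj : ∀ μ μ' : Measure Einf, IsProbabilityMeasure μ → IsProbabilityMeasure μ' →
      (∀ N, μ.bind (Linf N) = μ'.bind (Linf N)) → μ = μ')
    (Pl : ∀ N : ℕ, ℝ≥0 → Kernel (E N) (E N))
    [∀ N t, IsMarkovKernel (Pl N t)]
    (hsemi : ∀ N (s t : ℝ≥0), (Pl N t) ∘ₖ (Pl N s) = Pl N (s + t))
    (hPlFeller : ∀ N (t : ℝ≥0), IsFellerKernel (Pl N t))
    (hPlCont : ∀ N (f : C₀(E N, ℝ)) (t₀ : ℝ≥0) (ε : ℝ), 0 < ε →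
      ∃ δ : ℝ, 0 < δ ∧ ∀ t : ℝ≥0, dist t t₀ < δ →
        ∀ x : E N, |(∫ y, f y ∂((Pl N t) x)) - (∫ y, f y ∂((Pl N t₀) x))| ≤ ε)
    (P : ℝ≥0 → Kernel Einf Einf)
    [∀ t, IsMarkovKernel (P t)]
    (hPcompat : ∀ N (t : ℝ≥0), (Linf N) ∘ₖ (P t) = (Pl N t) ∘ₖ (Linf N)) :
    (∀ t : ℝ≥0, IsFellerKernel (P t)) ∧
    (∀ (f : C₀(Einf, ℝ)) (t₀ : ℝ≥0) (ε : ℝ), 0 < ε →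
      ∃ δ : ℝ, 0 < δ ∧ ∀ t : ℝ≥0, dist t t₀ < δ →
        ∀ x : Einf, |(∫ y, f y ∂((P t) x)) - (∫ y, f y ∂((P t₀) x))| ≤ ε) := by
  have happrox (f : C₀(Einf, ℝ)) {ε : ℝ} (hε : 0 < ε) : ∃ (N : ℕ) (g : C₀(E N, ℝ)),
      ∀ t x, |(∫ y, f y ∂(P t x)) - ∫ z, (∫ y, g y ∂(Pl N t z)) ∂(Linf N x)| ≤ ε := by
    obtain ⟨N, g, hg⟩ :=
      exists_abs_sub_integral_le E Einf Lk Linf hLkFeller hLinfFeller hcomm hinj f hε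
    refine ⟨N, g, fun t x => ?_⟩
    rw [← Kernel.integral_comp (g.integrable _), ← hPcompat, Kernel.integral_comp (g.integrable _)]
    simpa [IsFellerKernel.toLinearMap_apply] using abs_integral_sub_integral_le (f.integrable (P t x))
      (((hLinfFeller N).toLinearMap g).integrable (P t x)) hg
  refine ⟨fun t f => ?_, fun f t₀ ε hε => ?_⟩
  · choose N g hg using fun n : ℕ => happrox f (Nat.one_div_pos_of_nat (α := ℝ) (n := n))
    let F : ℕ → C₀(Einf, ℝ) := fun n =>
      (hLinfFeller (N n)).toLinearMap ((hPlFeller (N n) t).toLinearMap (g n))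
    have hF : TendstoUniformly (fun n x => F n x) (fun x => ∫ y, f y ∂(P t x)) Filter.atTop := by
      rw [Metric.tendstoUniformly_iff]
      intro ε hε
      filter_upwards [tendsto_one_div_add_atTop_nhds_zero_nat.eventually_lt_const hε] with n hn x
      exact (hg n t x).trans_lt hn
    refine ⟨hF.continuous (Filter.Frequently.of_forall fun n => map_continuous (F n)), ?_⟩
    rw [Metric.tendsto_nhds]
    intro ε hε
    obtain ⟨n, hn⟩ := (Metric.tendstoUniformly_iff.mp hF (ε / 2) (half_pos hε)).exists
    filter_upwards [Metric.tendsto_nhds.mp (zero_at_infty (F n)) (ε / 2) (half_pos hε)] with x hx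
    linarith [dist_triangle (∫ y, f y ∂(P t x)) (F n x) 0, hn x]
  · obtain ⟨N, g, hg⟩ := happrox f (show 0 < ε / 3 by positivity)
    obtain ⟨δ, hδ, hcont⟩ := hPlCont N g t₀ (ε / 3) (by positivity)
    refine ⟨δ, hδ, fun t ht x => ?_⟩
    have h1 := hg t x
    have h2 := hg t₀ x
    have h3 := abs_integral_sub_integral_le
      (((hPlFeller N t).toLinearMap g).integrable (Linf N x))
      (((hPlFeller N t₀).toLinearMap g).integrable (Linf N x)) (hcont t ht)
    simp only [IsFellerKernel.toLinearMap_apply, probReal_univ, mul_one] at h3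
    rw [abs_le] at h1 h2 h3 ⊢
    constructor <;> linarith
end

section
/- Let N ≥ 1, let λ ∈ GT_{N+1}, let μ = (μ_1 ≥ … ≥ μ_N ≥ 0) be a partition with at most N parts, and let c ∈ ℂ. Then Σ_{ν∈GT_N, ν≺λ} Λ^{N+1}_N(λ,ν) · F_{μ,c}(ν_1+N−1, ν_2+N−2, …, ν_N) = G_{μ,c}(λ_1+N, λ_2+N−1, …, λ_{N+1}). -/
/-- A signature of length `N`: a nonincreasing `N`-tuple of integers. -/
def Sig (N : ℕ) : Type := {f : Fin N → ℤ // ∀ i j : Fin N, i ≤ j → f j ≤ f i}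

instance {N : ℕ} : DecidableEq (Sig N) := by unfold Sig; infer_instance

/-- Interlacing `ν ≺ λ` between a signature of length `N` and one of length `N+1`. -/
def Interlace {N : ℕ} (ν : Sig N) (lam : Sig (N + 1)) : Prop :=
  ∀ i : Fin N, lam.1 i.succ ≤ ν.1 i ∧ ν.1 i ≤ lam.1 i.castSucc

instance {N : ℕ} (ν : Sig N) (lam : Sig (N + 1)) : Decidable (Interlace ν lam) := by
  unfold Interlace; infer_instance

/-- `∏_{i<j} (f i - i - f j + j)` (the Vandermonde-type product in shifted coordinates). -/
def vprod {N : ℕ} (f : Fin N → ℤ) : ℤ :=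
  ∏ i : Fin N, ∏ j : Fin N,
    if i < j then (f i - (i : ℕ) - f j + (j : ℕ)) else 1

/-- The link (cotransition probability) `Λ^{N+1}_N(λ, ν)`. -/
noncomputable def link {N : ℕ} (lam : Sig (N + 1)) (ν : Sig N) : ℝ :=
  if Interlace ν lam then (Nat.factorial N : ℝ) * (vprod ν.1 : ℝ) / (vprod lam.1 : ℝ) else 0

/-- Shifted coordinates of a signature: `l_j = λ_j + N − j` (1-based), i.e.
`lc λ i = λ_i + N − 1 − i` in 0-based indexing. -/
def lc {N : ℕ} (lam : Sig N) : Fin N → ℤ :=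
  fun i => lam.1 i + (N : ℤ) - 1 - (i : ℕ)

/-- The Vandermonde product `∏_{i<j} (x_i − x_j)` (as a complex number). -/
def Vc {N : ℕ} (x : Fin N → ℤ) : ℂ :=
  ∏ i : Fin N, ∏ j : Fin N, if i < j then ((x i : ℂ) - (x j : ℂ)) else 1

/-- The one-dimensional bilateral birth-and-death rate matrix `𝒟` on `ℤ` with
parameters `(u,u',v,v')`. -/
def Dmat (u u' v v' : ℂ) (x y : ℤ) : ℂ :=
  if y = x + 1 then ((x : ℂ) - u) * ((x : ℂ) - u')
  else if y = x - 1 then ((x : ℂ) + v) * ((x : ℂ) + v')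
  else if y = x then -(((x : ℂ) - u) * ((x : ℂ) - u')) - ((x : ℂ) + v) * ((x : ℂ) + v')
  else 0

/-- The constant `d_N = N(N−1)(N−2)/3 − (u+u'+v+v')·N(N−1)/2`. -/
noncomputable def dConst (u u' v v' : ℂ) (N : ℕ) : ℂ :=
  (N : ℂ) * ((N : ℂ) - 1) * ((N : ℂ) - 2) / 3 -
    (u + u' + v + v') * ((N : ℂ) * ((N : ℂ) - 1)) / 2

/-- The matrix `𝒟^{(N)}` of transition rates on `GT_N`:
`𝒟^{(N)}(λ,ν) = (V(n)/V(l)) Σ_i 𝒟(l_i,n_i)·[l_j = n_j ∀ j ≠ i] − d_N·[λ = ν]`. -/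
noncomputable def DN (u u' v v' : ℂ) {N : ℕ} (lam ν : Sig N) : ℂ :=
  (Vc (lc ν) / Vc (lc lam)) *
      (∑ i : Fin N,
        if ∀ j : Fin N, j ≠ i → lc lam j = lc ν j then
          Dmat u u' v v' (lc lam i) (lc ν i) else 0) -
    (if lam = ν then dConst u u' v v' N else 0)

/-- The falling factorial `a^{↓k} = a(a−1)⋯(a−k+1)`. -/
def ffall (a : ℂ) (k : ℕ) : ℂ := ∏ i ∈ Finset.range k, (a - (i : ℕ))

/-- The Pochhammer symbol `(a)_k = a(a+1)⋯(a+k−1)`. -/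
def poch (a : ℂ) (k : ℕ) : ℂ := ∏ i ∈ Finset.range k, (a + (i : ℕ))

/-- `(a)_μ = ∏_{j=1}^N (a−j+1)_{μ_j}` for a partition `μ` with at most `N` parts. -/
def pochPar {N : ℕ} (a : ℂ) (μ : Fin N → ℕ) : ℂ :=
  ∏ i : Fin N, poch (a - (i : ℕ)) (μ i)

/-- The symmetric function
`F_{μ,c}(x_1,…,x_N) = (N)_μ^{−1} det[(x_i+c)^{↓(μ_j+N−j)}] / ∏_{i<j}(x_i−x_j)`. -/
noncomputable def Ffun {N : ℕ} (μ : Fin N → ℕ) (c : ℂ) (x : Fin N → ℂ) : ℂ :=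
  (pochPar (N : ℂ) μ)⁻¹ *
      Matrix.det (Matrix.of fun i j : Fin N => ffall (x i + c) (μ j + (N - 1 - (j : ℕ)))) /
    ∏ i : Fin N, ∏ j : Fin N, if i < j then (x i - x j) else 1

/-- The symmetric function
`G_{μ,c}(x_1,…,x_{N+1}) = (N+1)_μ^{−1} det[(x_i+c)^{↓(μ_j+N+1−j)}] / ∏_{i<j}(x_i−x_j)`,
with the convention `μ_{N+1} = 0`. -/
noncomputable def Gfun {N : ℕ} (μ : Fin N → ℕ) (c : ℂ) (x : Fin (N + 1) → ℂ) : ℂ :=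
  (pochPar ((N : ℂ) + 1) μ)⁻¹ *
      Matrix.det (Matrix.of fun i j : Fin (N + 1) =>
        ffall (x i + c) ((if h : (j : ℕ) < N then μ ⟨j, h⟩ else 0) + (N - (j : ℕ)))) /
    ∏ i : Fin (N + 1), ∏ j : Fin (N + 1), if i < j then (x i - x j) else 1

theorem ffall_succ (a : ℂ) (k : ℕ) : ffall a (k + 1) = ffall a k * (a - k) :=
  Finset.prod_range_succ _ _

theorem ffall_add_one_succ (a : ℂ) (k : ℕ) : ffall (a + 1) (k + 1) = (a + 1) * ffall a k := by
  unfold ffall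
  rw [Finset.prod_range_succ', mul_comm]
  congr 1
  · simp
  · exact Finset.prod_congr rfl fun i _ => by push_cast; ring

theorem ffall_forward_diff (a : ℂ) (k : ℕ) :
    ffall (a + 1) (k + 1) - ffall a (k + 1) = (k + 1) * ffall a k := by
  rw [ffall_add_one_succ, ffall_succ]; ring

theorem sum_Ico_ffall (c : ℂ) (k : ℕ) {a b : ℤ} (hab : a ≤ b) :
    (k + 1 : ℂ) * ∑ n ∈ Finset.Ico a b, ffall (n + c) k =
      ffall (b + c) (k + 1) - ffall (a + c) (k + 1) := by
  induction b, hab using Int.leInduction with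
  | base => simp
  | succ b hab ih =>
    rw [← Finset.insert_Ico_right_eq_Ico_add_one hab, Finset.sum_insert (by simp), mul_add, ih,
      ← ffall_forward_diff]
    push_cast
    rw [add_right_comm (b : ℂ) c 1]
    ring

theorem poch_succ_left (a : ℂ) (k : ℕ) : poch a (k + 1) = a * poch (a + 1) k := by
  unfold poch
  rw [Finset.prod_range_succ', mul_comm]
  congr 1
  · simp
  · exact Finset.prod_congr rfl fun i _ => by push_cast; ring

theorem mul_poch_add_one (a : ℂ) (k : ℕ) : a * poch (a + 1) k = poch a k * (a + k) := by
  rw [← poch_succ_left]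
  exact Finset.prod_range_succ _ _

theorem prod_natCast_sub_fin (N : ℕ) : ∏ i : Fin N, ((N : ℂ) - (i : ℕ)) = N.factorial := by
  rw [Fin.prod_univ_eq_prod_range (fun i => (N : ℂ) - (i : ℕ)) N, ← Finset.prod_range_reflect,
    ← Finset.prod_range_add_one_eq_factorial]
  push_cast
  refine Finset.prod_congr rfl fun i hi => ?_
  rw [Nat.cast_sub (by have := Finset.mem_range.1 hi; omega),
    Nat.cast_sub (by have := Finset.mem_range.1 hi; omega)]
  push_cast; ring

theorem factorial_mul_pochPar_add_one {N : ℕ} (μ : Fin N → ℕ) :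
    (N.factorial : ℂ) * pochPar ((N : ℂ) + 1) μ =
      pochPar (N : ℂ) μ * ∏ i : Fin N, ((μ i + (N - 1 - (i : ℕ)) : ℕ) + 1 : ℂ) := by
  rw [← prod_natCast_sub_fin]
  unfold pochPar
  rw [← Finset.prod_mul_distrib, ← Finset.prod_mul_distrib]
  refine Finset.prod_congr rfl fun i _ => ?_
  rw [show (N : ℂ) + 1 - (i : ℕ) = (N : ℂ) - (i : ℕ) + 1 by ring, mul_poch_add_one]
  have h : ((μ i + (N - 1 - (i : ℕ)) : ℕ) + 1 : ℂ) = ((μ i + (N - (i : ℕ)) : ℕ) : ℂ) := by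
    norm_cast; omega
  rw [h, Nat.cast_add, Nat.cast_sub i.2.le]
  ring

theorem pochPar_ne_zero {N : ℕ} (M : ℕ) (hM : N ≤ M) (μ : Fin N → ℕ) :
    pochPar (M : ℂ) μ ≠ 0 := by
  refine Finset.prod_ne_zero_iff.2 fun i _ => Finset.prod_ne_zero_iff.2 fun j _ => ?_
  rw [← Nat.cast_sub (i.2.le.trans hM), ← Nat.cast_add, Nat.cast_ne_zero]
  omega

theorem Matrix.det_eq_det_sub_succ_of_last_col_eq_one {R : Type*} [CommRing R] {n : ℕ}
    (A : Matrix (Fin (n + 1)) (Fin (n + 1)) R) (hA : ∀ i, A i (Fin.last n) = 1) :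
    A.det = (Matrix.of fun i j : Fin n =>
      A i.castSucc j.castSucc - A i.succ j.castSucc).det := by
  let B : Matrix (Fin (n + 1)) (Fin (n + 1)) R :=
    Matrix.of fun i j => Fin.cases (A 0 j) (fun k => A k.succ j - A k.castSucc j) i
  have hAB : A.det = B.det :=
    Matrix.det_eq_of_forall_row_eq_smul_add_pred (fun _ => 1) (fun j => by simp [B])
      (fun i j => by simp [B])
  have hneg : (Matrix.of fun i j : Fin n =>
      A i.castSucc j.castSucc - A i.succ j.castSucc) =
      -B.submatrix Fin.succ Fin.castSucc := by
    ext i j; simp [B]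
  rw [hAB, hneg, Matrix.det_neg, Fintype.card_fin, Matrix.det_succ_column B (Fin.last n),
    Fin.sum_univ_succ, Finset.sum_eq_zero]
  · simp [B, hA]
  · intro i _
    simp [B, hA]

theorem sum_piFinset_det {N : ℕ} (c : ℂ) (m : Fin N → ℕ) (l : Fin (N + 1) → ℤ)
    (hl : ∀ i : Fin N, l i.succ ≤ l i.castSucc) :
    (∏ j, (m j + 1 : ℂ)) *
      ∑ n ∈ Fintype.piFinset fun i : Fin N => Finset.Ico (l i.succ) (l i.castSucc),
        (Matrix.of fun i j : Fin N => ffall (n i + c) (m j)).det =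
      (Matrix.of fun i j : Fin N =>
        ffall (l i.castSucc + c) (m j + 1) - ffall (l i.succ + c) (m j + 1)).det := by
  have h := (Matrix.detRowAlternating (n := Fin N) (R := ℂ)).toMultilinearMap.map_sum_finset
    (fun (_ : Fin N) (n : ℤ) (j : Fin N) => ffall (n + c) (m j))
    (fun i : Fin N => Finset.Ico (l i.succ) (l i.castSucc))
  have h' : ∑ n ∈ Fintype.piFinset fun i : Fin N => Finset.Ico (l i.succ) (l i.castSucc),
        (Matrix.of fun i j : Fin N => ffall (n i + c) (m j)).det =
      (Matrix.of fun i j : Fin N =>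
        ∑ n ∈ Finset.Ico (l i.succ) (l i.castSucc), ffall (n + c) (m j)).det := by
    refine h.symm.trans ?_
    change Matrix.det _ = Matrix.det _
    congr 1
    ext i j
    simp [Finset.sum_apply]
  rw [h', ← Matrix.det_mul_row]
  congr 1
  ext i j
  simp only [Matrix.of_apply]
  exact sum_Ico_ffall c (m j) (hl i)

theorem lc_injective (N : ℕ) : Function.Injective (lc : Sig N → Fin N → ℤ) := by
  intro a b h
  refine Subtype.ext (funext fun i => ?_)
  have := congrFun h i
  simp only [lc] at this
  omega

theorem interlace_iff_lc_mem {N : ℕ} (ν : Sig N) (lam : Sig (N + 1)) :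
    Interlace ν lam ↔
      lc ν ∈ Fintype.piFinset fun i : Fin N => Finset.Ico (lc lam i.succ) (lc lam i.castSucc) := by
  simp only [Interlace, Fintype.mem_piFinset, Finset.mem_Ico, lc, Fin.val_succ, Fin.val_castSucc]
  refine forall_congr' fun i => ?_
  push_cast
  constructor <;> rintro ⟨h₁, h₂⟩ <;> constructor <;> omega

theorem mem_range_lc_of_mem_piFinset {N : ℕ} (lam : Sig (N + 1)) (n : Fin N → ℤ)
    (hn : n ∈ Fintype.piFinset fun i : Fin N =>
      Finset.Ico (lc lam i.succ) (lc lam i.castSucc)) :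
    n ∈ Set.range (lc : Sig N → Fin N → ℤ) := by
  simp only [Fintype.mem_piFinset, Finset.mem_Ico, lc, Fin.val_succ, Fin.val_castSucc] at hn
  push_cast at hn
  refine ⟨⟨fun i => n i - N + 1 + (i : ℕ), fun i j hij => ?_⟩, funext fun i => ?_⟩
  · rcases hij.eq_or_lt with rfl | hlt
    · exact le_rfl
    · have h₁ := (hn i).1
      have h₂ := (hn j).2
      have h₃ := lam.2 i.succ j.castSucc (by simpa [Fin.le_def] using hlt)
      dsimp only
      omega
  · simp only [lc]; ring

theorem vprod_eq_prod_lc {N : ℕ} (ν : Sig N) :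
    (vprod ν.1 : ℂ) =
      ∏ i : Fin N, ∏ j : Fin N, if i < j then ((lc ν i : ℂ) - (lc ν j : ℂ)) else 1 := by
  unfold vprod
  push_cast
  refine Finset.prod_congr rfl fun i _ => Finset.prod_congr rfl fun j _ => ?_
  split_ifs
  · simp only [lc]; push_cast; ring
  · simp

theorem vprod_ne_zero {N : ℕ} (ν : Sig N) : vprod ν.1 ≠ 0 := by
  refine Finset.prod_ne_zero_iff.2 fun i _ => Finset.prod_ne_zero_iff.2 fun j _ => ?_
  split_ifs with h
  · have := ν.2 i j h.le
    have : (i : ℕ) < j := h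
    omega
  · exact one_ne_zero

/-- Lemma 4.4 of Borodin–Olshanski: for every `λ ∈ GT_{N+1}`, partition `μ` with at most
`N` parts, and `c ∈ ℂ`,
`Σ_ν Λ^{N+1}_N(λ,ν) F_{μ,c}(ν_1+N−1,…,ν_N) = G_{μ,c}(λ_1+N,…,λ_{N+1})`. -/
theorem stmt12 (N : ℕ) (hN : 1 ≤ N) (lam : Sig (N + 1))
    (μ : Fin N → ℕ) (hμ : ∀ i j : Fin N, i ≤ j → μ j ≤ μ i) (c : ℂ) :
    ∑ᶠ ν : Sig N, ((link lam ν : ℝ) : ℂ) * Ffun μ c (fun i => ((lc ν i : ℤ) : ℂ))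
      = Gfun μ c (fun i => ((lc lam i : ℤ) : ℂ)) := by
  classical
  set P := Fintype.piFinset fun i : Fin N =>
    Finset.Ico (lc lam i.succ) (lc lam i.castSucc) with hP
  let m : Fin N → ℕ := fun j => μ j + (N - 1 - (j : ℕ))
  let K : ℂ := N.factorial * (pochPar (N : ℂ) μ)⁻¹ / vprod lam.1
  let g : (Fin N → ℤ) → ℂ := fun n =>
    if n ∈ P then K * (Matrix.of fun i j : Fin N => ffall (n i + c) (m j)).det else 0
  have hterm : ∀ ν : Sig N,
      ((link lam ν : ℝ) : ℂ) * Ffun μ c (fun i => ((lc ν i : ℤ) : ℂ)) = g (lc ν) := by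
    intro ν
    have hν : (vprod ν.1 : ℂ) ≠ 0 := Int.cast_ne_zero.2 (vprod_ne_zero ν)
    simp only [g, link, interlace_iff_lc_mem, ← hP]
    split_ifs
    · simp only [Ffun, ← vprod_eq_prod_lc, K, m]
      push_cast
      field_simp
    · simp
  have hsum : ∑ᶠ ν : Sig N, g (lc ν) =
      K * ∑ n ∈ P, (Matrix.of fun i j : Fin N => ffall (n i + c) (m j)).det := by
    rw [← finsum_mem_range (f := g) (lc_injective N),
      finsum_mem_inter_support_eq g _ (P : Set (Fin N → ℤ)), finsum_mem_coe_finset,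
      Finset.mul_sum]
    · exact Finset.sum_congr rfl fun n hn => if_pos hn
    · ext n
      simp only [Set.mem_inter_iff, Finset.mem_coe, and_congr_left_iff, Function.mem_support]
      intro hn
      have hnP : n ∈ P := by by_contra h; exact hn (if_neg h)
      exact iff_of_true (mem_range_lc_of_mem_piFinset lam n hnP) hnP
  have hl : ∀ i : Fin N, lc lam i.succ ≤ lc lam i.castSucc := by
    intro i
    have := lam.2 i.castSucc i.succ (Fin.castSucc_lt_succ).le
    simp only [lc, Fin.val_succ, Fin.val_castSucc]
    push_cast
    omega
  have hdet := sum_piFinset_det c m (lc lam) hl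
  have hG : (Matrix.of fun i j : Fin (N + 1) =>
        ffall (lc lam i + c) ((if h : (j : ℕ) < N then μ ⟨j, h⟩ else 0) + (N - (j : ℕ)))).det =
      (Matrix.of fun i j : Fin N =>
        ffall (lc lam i.castSucc + c) (m j + 1) - ffall (lc lam i.succ + c) (m j + 1)).det := by
    rw [Matrix.det_eq_det_sub_succ_of_last_col_eq_one _ (fun i => by simp [ffall])]
    congr 1
    ext i j
    have hj : μ j + (N - (j : ℕ)) = m j + 1 := by simp only [m]; omega
    simp [hj]
  have hpoch := factorial_mul_pochPar_add_one μ
  have h₁ : pochPar (N : ℂ) μ ≠ 0 := pochPar_ne_zero N le_rfl μ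
  have h₂ : pochPar ((N : ℂ) + 1) μ ≠ 0 := by
    exact_mod_cast pochPar_ne_zero (N + 1) N.le_succ μ
  have hV : (vprod lam.1 : ℂ) ≠ 0 := Int.cast_ne_zero.2 (vprod_ne_zero lam)
  simp only [hterm]
  rw [hsum, Gfun, hG, ← hdet, ← vprod_eq_prod_lc]
  simp only [K]
  field_simp
  linear_combination
    (∑ n ∈ P, (Matrix.of fun i j : Fin N => ffall (n i + c) (m j)).det) * hpoch
end
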